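/- There exists (in ZFC) a Hausdorff topological space X of cardinality 2^ℵ⁰ which is locally countable, locally compact, 0-dimensional, not linearly D, and such that e(F) = L(F) for every closed subset F ⊆ X, where e(F) is the extent of F and L(F) the Lindelöf number of F. -/

import Mathlib

open Set Cardinal Topology Filter

/-- `X` is *linearly D*: every open neighborhood assignment whose range is
linearly ordered (monotone) by inclusion has a closed discrete kernel. -/
def IsLinearlyDSpace (X : Type*) [TopologicalSpace X] : Prop :=
  ∀ U : X → Set X, (∀ x, IsOpen (U x)) → (∀ x, x ∈ U x) →
    (∀ x y, U x ⊆ U y ∨ U y ⊆ U x) →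
    ∃ D : Set X, IsClosed D ∧ DiscreteTopology ↥D ∧ ⋃ d ∈ D, U d = Set.univ

/-- `X` is *locally countable*: every point has a countable neighborhood. -/
def LocallyCountable (X : Type*) [TopologicalSpace X] : Prop :=
  ∀ x : X, ∃ U ∈ nhds x, U.Countable

/-- `X` is *0-dimensional*: it has a base consisting of clopen sets. -/
def ZeroDimensional (X : Type*) [TopologicalSpace X] : Prop :=
  ∀ (x : X) (U : Set X), IsOpen U → x ∈ U → ∃ V : Set X, IsClopen V ∧ x ∈ V ∧ V ⊆ U

/-- The *extent* of `Y`: the supremum of cardinalities of closed discrete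
subsets of `Y`, joined with `ℵ₀`. -/
noncomputable def spaceExtent (Y : Type*) [TopologicalSpace Y] : Cardinal :=
  max Cardinal.aleph0
    (sSup {c : Cardinal | ∃ D : Set Y, IsClosed D ∧ DiscreteTopology ↥D ∧ #↥D = c})

/-- The *Lindelöf number* of `Y`: the least infinite cardinal `κ` such that
every open cover of `Y` has a subcover of cardinality at most `κ`. -/
noncomputable def lindelofNumber (Y : Type*) [TopologicalSpace Y] : Cardinal :=
  sInf {κ : Cardinal | Cardinal.aleph0 ≤ κ ∧
    ∀ 𝓤 : Set (Set Y), (∀ u ∈ 𝓤, IsOpen u) → ⋃₀ 𝓤 = Set.univ →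
      ∃ 𝓥 : Set (Set Y), 𝓥 ⊆ 𝓤 ∧ #↥𝓥 ≤ κ ∧ ⋃₀ 𝓥 = Set.univ}

/-- A family of sets indexed by `I`, each of cardinality at least `#I`, has an injective
choice function. -/
theorem exists_injective_choice {I X : Type} (S : I → Set X) (hS : ∀ i, #I ≤ #(S i)) :
    ∃ g : I → X, Function.Injective g ∧ ∀ i, g i ∈ S i := by
  obtain ⟨_, _, hI⟩ := exists_ord_eq_type_lt I
  have key : ∀ (i : I) (f : ∀ j, j < i → X), ∃ x ∈ S i, ∀ j (h : j < i), f j h ≠ x := by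
    intro i f
    by_contra! hcon
    have hsub : S i ⊆ range fun j : Iio i ↦ f j j.2 := fun x hx ↦ by
      obtain ⟨j, hj, rfl⟩ := hcon x hx
      exact ⟨⟨j, hj⟩, rfl⟩
    exact ((hS i).trans ((mk_le_mk_of_subset hsub).trans mk_range_le)).not_gt (mk_Iio_lt i hI)
  choose step hstep_mem hstep_ne using key
  let g : I → X := wellFounded_lt.fix step
  have hg : ∀ i, g i = step i fun j _ ↦ g j := fun i ↦ wellFounded_lt.fix_eq step i
  have hne : ∀ i j, j < i → g j ≠ g i := fun i j h ↦ by
    rw [hg i]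
    exact hstep_ne i (fun j _ ↦ g j) j h
  refine ⟨g, fun i j hij ↦ ?_, fun i ↦ ?_⟩
  · rcases lt_trichotomy i j with h | h | h
    · exact absurd hij (hne j i h)
    · exact h
    · exact absurd hij.symm (hne i j h)
  · rw [hg i]
    exact hstep_mem i _

theorem continuum_le_mk_of_isClosed {F : Set ℝ} (hF : IsClosed F) (h : ¬F.Countable) :
    𝔠 ≤ #F := by
  obtain ⟨f, hfF, -, hf⟩ := hF.exists_nat_bool_injection_of_not_countable h
  have := mk_le_of_injective (f := fun a ↦ (⟨f a, hfF ⟨a, rfl⟩⟩ : F))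
    fun a b hab ↦ hf (congrArg Subtype.val hab)
  simpa using this

/-- The reals can be labelled by levels in `W` and by sequences so that each sequence with
uncountable closure is, on each level, the label of continuum many points of its closure. -/
theorem exists_labelling (W : Type) [Nonempty W] (hW : #W ≤ 𝔠) :
    ∃ (level : ℝ → W) (label : ℝ → ℕ → ℝ), ∀ s : ℕ → ℝ, ¬(closure (range s)).Countable →
      ∀ β : W, ∃ h : ℝ → ℝ, Function.Injective h ∧
        ∀ ξ, h ξ ∈ closure (range s) ∧ level (h ξ) = β ∧ label (h ξ) = s := by
  let I := {s : ℕ → ℝ // ¬(closure (range s)).Countable} × W × ℝ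
  have hI : #I ≤ 𝔠 := by
    have h1 : #{s : ℕ → ℝ // ¬(closure (range s)).Countable} ≤ 𝔠 :=
      (mk_subtype_le _).trans (by simp [mk_real])
    simp only [I, mk_prod, lift_id, mk_real]
    exact mul_le_of_le aleph0_le_continuum h1 (mul_le_of_le aleph0_le_continuum hW le_rfl)
  obtain ⟨g, hg, hgS⟩ := exists_injective_choice (fun i : I ↦ closure (range i.1.1))
    fun i ↦ hI.trans (continuum_le_mk_of_isClosed isClosed_closure i.1.2)
  obtain ⟨w⟩ := ‹Nonempty W›
  refine ⟨Function.extend g (fun i ↦ i.2.1) fun _ ↦ w,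
    Function.extend g (fun i ↦ i.1.1) fun _ _ ↦ 0, fun s hs β ↦
    ⟨fun ξ ↦ g (⟨s, hs⟩, β, ξ), fun ξ η h ↦ ?_, fun ξ ↦ ⟨hgS (⟨s, hs⟩, β, ξ), ?_, ?_⟩⟩⟩
  · exact congrArg (fun i : I ↦ i.2.2) (hg h)
  · exact hg.extend_apply _ _ _
  · exact hg.extend_apply _ _ _

/-- A countable subset of an uncountable linear order with countable initial segments is
strictly bounded above. -/
theorem exists_forall_lt_of_countable {W : Type} [LinearOrder W] [Uncountable W]
    (hW : ∀ w : W, (Iio w).Countable) {S : Set W} (hS : S.Countable) : ∃ β, ∀ w ∈ S, w < β := by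
  by_contra! h
  have huniv : (univ : Set W) ⊆ ⋃ w ∈ S, Iic w := fun β _ ↦ by
    obtain ⟨w, hw, hβ⟩ := h β
    exact mem_biUnion hw hβ
  refine not_countable_univ ((hS.biUnion fun w _ ↦ ?_).mono huniv)
  rw [← Iio_insert]
  exact (hW w).insert w

/-- A ladder system: the reals are divided into levels, and every point `x` of `limit` carries
a sequence `step x` of points of lower level converging to it.  The number `index x n` tells how
small the neighborhood of `step x n` has to be that goes into the neighborhoods of `x`. -/
structure LadderSystem (W : Type) [LinearOrder W] where
  level : ℝ → W
  rank : W → W → ℕ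
  limit : Set ℝ
  step : ℝ → ℕ → ℝ
  index : ℝ → ℕ → ℕ
  level_step_lt : ∀ x ∈ limit, ∀ n, level (step x n) < level x
  le_rank_step : ∀ x ∈ limit, ∀ n, n ≤ rank (level x) (level (step x n))
  dist_step_le : ∀ x ∈ limit, ∀ n, dist (step x n) x ≤ (1 / 2) ^ (n + 1)
  lt_index : ∀ x ∈ limit, ∀ n, n < index x n
  rank_lt_index : ∀ x ∈ limit, ∀ n, ∀ α < level (step x n),
    rank (level x) α < n → rank (level (step x n)) α < index x n

namespace LadderSystem

variable {W : Type} [LinearOrder W] (L : LadderSystem W)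

/-- The basic neighborhoods of a ladder system: `Near x k y` means that `y` belongs to the `k`-th
basic neighborhood of `x`. -/
inductive Near : ℝ → ℕ → ℝ → Prop
  | refl (x : ℝ) (k : ℕ) : Near x k x
  | step {x : ℝ} {k n : ℕ} {y : ℝ} (hx : x ∈ L.limit) (hkn : k ≤ n)
      (h : Near (L.step x n) (L.index x n) y) : Near x k y

/-- The `k`-th basic neighborhood of `x`. -/
def ball (x : ℝ) (k : ℕ) : Set ℝ := {y | L.Near x k y}

variable {L}

theorem mem_ball_self (x : ℝ) (k : ℕ) : x ∈ L.ball x k := Near.refl x k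

theorem ball_step_subset {x : ℝ} {k n : ℕ} (hx : x ∈ L.limit) (hkn : k ≤ n) :
    L.ball (L.step x n) (L.index x n) ⊆ L.ball x k := fun _ h ↦ Near.step hx hkn h

theorem ball_anti (x : ℝ) {k m : ℕ} (hkm : k ≤ m) : L.ball x m ⊆ L.ball x k := by
  rintro y (_ | ⟨hx, hmn, h⟩)
  · exact mem_ball_self x k
  · exact ball_step_subset hx (hkm.trans hmn) h

theorem exists_ball_subset {x y : ℝ} {k : ℕ} (h : y ∈ L.ball x k) :
    ∃ m, L.ball y m ⊆ L.ball x k := by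
  induction h with
  | refl x k => exact ⟨k, subset_rfl⟩
  | step hx hkn _ ih =>
    obtain ⟨m, hm⟩ := ih
    exact ⟨m, hm.trans (ball_step_subset hx hkn)⟩

theorem eq_or_level_lt {x y : ℝ} {k : ℕ} (h : y ∈ L.ball x k) :
    y = x ∨ L.level y < L.level x ∧ k ≤ L.rank (L.level x) (L.level y) := by
  induction h with
  | refl x k => exact .inl rfl
  | @step x k n y hx hkn _ ih =>
    right
    rcases ih with rfl | ⟨hlt, hrank⟩
    · exact ⟨L.level_step_lt x hx n, hkn.trans (L.le_rank_step x hx n)⟩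
    · refine ⟨hlt.trans (L.level_step_lt x hx n), hkn.trans ?_⟩
      by_contra! hn
      exact (L.rank_lt_index x hx n _ hlt hn).not_ge hrank

theorem level_le_of_mem_ball {x y : ℝ} {k : ℕ} (h : y ∈ L.ball x k) : L.level y ≤ L.level x := by
  rcases eq_or_level_lt h with rfl | h
  · exact le_rfl
  · exact h.1.le

theorem dist_le_of_mem_ball {x y : ℝ} {k : ℕ} (h : y ∈ L.ball x k) :
    dist y x ≤ (1 / 2) ^ k := by
  induction h with
  | refl x k => simp
  | @step x k n y hx hkn _ ih =>
    have h1 : ((1 / 2 : ℝ)) ^ L.index x n ≤ (1 / 2) ^ (n + 1) :=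
      pow_le_pow_of_le_one (by norm_num) (by norm_num) (L.lt_index x hx n)
    have h2 : ((1 / 2 : ℝ)) ^ n ≤ (1 / 2) ^ k :=
      pow_le_pow_of_le_one (by norm_num) (by norm_num) hkn
    have h3 := dist_triangle y (L.step x n) x
    have h4 := L.dist_step_le x hx n
    have h5 : ((1 / 2 : ℝ)) ^ (n + 1) = (1 / 2) ^ n / 2 := by ring
    linarith

theorem ball_eq_insert {x : ℝ} (hx : x ∈ L.limit) (k : ℕ) :
    L.ball x k = insert x (⋃ n ∈ Ici k, L.ball (L.step x n) (L.index x n)) := by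
  ext y
  constructor
  · rintro (_ | ⟨_, hkn, h⟩)
    · exact .inl rfl
    · exact .inr (mem_biUnion hkn h)
  · rintro (rfl | h)
    · exact mem_ball_self y k
    · obtain ⟨n, hn, h⟩ := mem_iUnion₂.1 h
      exact ball_step_subset hx hn h

theorem ball_eq_singleton {x : ℝ} (hx : x ∉ L.limit) (k : ℕ) : L.ball x k = {x} := by
  ext y
  constructor
  · rintro (_ | ⟨h, _, _⟩)
    · rfl
    · exact absurd h hx
  · rintro rfl
    exact mem_ball_self y k

theorem countable_ball [WellFoundedLT W] (x : ℝ) (k : ℕ) : (L.ball x k).Countable := by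
  induction x using (InvImage.wf L.level wellFounded_lt).induction generalizing k with
  | _ x ih =>
    by_cases hx : x ∈ L.limit
    · rw [ball_eq_insert hx]
      exact ((to_countable _).biUnion fun n _ ↦ ih _ (L.level_step_lt x hx n) _).insert x
    · rw [ball_eq_singleton hx]
      exact countable_singleton x

variable (L) in
/-- The real line with the topology generated by the basic neighborhoods of a ladder system. -/
def Space (_ : LadderSystem W) : Type := ℝ

instance : TopologicalSpace L.Space where
  IsOpen U := ∀ x ∈ U, ∃ k, L.ball x k ⊆ U
  isOpen_univ _ _ := ⟨0, subset_univ _⟩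
  isOpen_inter U V hU hV x hx := by
    obtain ⟨k, hk⟩ := hU x hx.1
    obtain ⟨m, hm⟩ := hV x hx.2
    exact ⟨max k m, subset_inter ((ball_anti x (le_max_left k m)).trans hk)
      ((ball_anti x (le_max_right k m)).trans hm)⟩
  isOpen_sUnion S hS x := by
    rintro ⟨U, hU, hx⟩
    obtain ⟨k, hk⟩ := hS U hU x hx
    exact ⟨k, hk.trans (subset_sUnion_of_mem hU)⟩

variable (L) in
/-- The basic neighborhoods as sets of the space of the ladder system. -/
def basic (x : L.Space) (k : ℕ) : Set L.Space := L.ball x k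

theorem isOpen_iff {U : Set L.Space} : IsOpen U ↔ ∀ x ∈ U, ∃ k, L.basic x k ⊆ U := Iff.rfl

theorem isOpen_basic (x : L.Space) (k : ℕ) : IsOpen (L.basic x k) :=
  fun _ hy ↦ exists_ball_subset hy

theorem basic_mem_nhds (x : L.Space) (k : ℕ) : L.basic x k ∈ 𝓝 x :=
  (isOpen_basic x k).mem_nhds (mem_ball_self x k)

variable (L) in
/-- The identity map to the real line with its usual topology. -/
def toReal (x : L.Space) : ℝ := x

theorem continuous_toReal : Continuous L.toReal := by
  refine continuous_def.2 fun U hU x hx ↦ ?_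
  obtain ⟨ε, hε, hball⟩ := Metric.isOpen_iff.1 hU _ hx
  obtain ⟨k, hk⟩ := exists_pow_lt_of_lt_one hε (show (1 / 2 : ℝ) < 1 by norm_num)
  exact ⟨k, fun y hy ↦ hball ((dist_le_of_mem_ball hy).trans_lt hk)⟩

instance : T2Space L.Space :=
  T2Space.of_injective_continuous (f := L.toReal) (fun _ _ h ↦ h) continuous_toReal

theorem isCompact_basic [WellFoundedLT W] (x : L.Space) (k : ℕ) : IsCompact (L.basic x k) := by
  induction x using (InvImage.wf L.level wellFounded_lt).induction generalizing k with
  | _ x ih =>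
    by_cases hx : x ∈ L.limit
    · have hsub : ∀ m, L.basic x k ⊆
          L.basic x m ∪ ⋃ n ∈ Ico k m, L.basic (L.step x n) (L.index x n) := fun m y hy ↦ by
        rcases (ball_eq_insert hx k).subset hy with rfl | hy
        · exact .inl (mem_ball_self _ m)
        · obtain ⟨n, hkn, hn⟩ := mem_iUnion₂.1 hy
          rcases le_or_gt m n with hmn | hmn
          · exact .inl (ball_step_subset hx hmn hn)
          · exact .inr (mem_biUnion (mem_Ico.2 ⟨hkn, hmn⟩) hn)
      refine isCompact_of_finite_subcover fun {ι} U hU hcover ↦ ?_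
      obtain ⟨i, hi⟩ := mem_iUnion.1 (hcover (mem_ball_self x k))
      obtain ⟨m, hm⟩ := hU i x hi
      have hK : IsCompact (⋃ n ∈ Ico k m, L.basic (L.step x n) (L.index x n)) :=
        (finite_Ico k m).isCompact_biUnion fun n _ ↦ ih _ (L.level_step_lt x hx n) _
      obtain ⟨t, ht⟩ := hK.elim_finite_subcover U hU <|
        (iUnion₂_subset fun n hn ↦ ball_step_subset hx hn.1).trans hcover
      classical
      refine ⟨insert i t, fun y hy ↦ ?_⟩
      rcases hsub m hy with h | h
      · exact mem_biUnion (Finset.mem_insert_self i t) (hm h)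
      · obtain ⟨j, hj, hyj⟩ := mem_iUnion₂.1 (ht h)
        exact mem_biUnion (Finset.mem_insert_of_mem hj) hyj
    · have : L.basic x k = {x} := ball_eq_singleton hx k
      rw [this]
      exact isCompact_singleton

theorem isClopen_basic [WellFoundedLT W] (x : L.Space) (k : ℕ) : IsClopen (L.basic x k) :=
  ⟨(isCompact_basic x k).isClosed, isOpen_basic x k⟩

instance [WellFoundedLT W] : LocallyCompactSpace L.Space :=
  ⟨fun x _ hn ↦ by
    obtain ⟨U, hU, hUo, hxU⟩ := mem_nhds_iff.1 hn
    obtain ⟨k, hk⟩ := hUo x hxU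
    exact ⟨L.basic x k, basic_mem_nhds x k, hk.trans hU, isCompact_basic x k⟩⟩

theorem zeroDimensional [WellFoundedLT W] : ZeroDimensional L.Space := fun x _ hU hx ↦ by
  obtain ⟨k, hk⟩ := hU x hx
  exact ⟨L.basic x k, isClopen_basic x k, mem_ball_self x k, hk⟩

theorem locallyCountable [WellFoundedLT W] : LocallyCountable L.Space := fun x ↦
  ⟨L.basic x 0, basic_mem_nhds x 0, countable_ball x 0⟩

theorem isOpen_setOf_level_le (w : W) : IsOpen {x : L.Space | L.level x ≤ w} := fun _ hx ↦
  ⟨0, fun _ hy ↦ (level_le_of_mem_ball hy).trans hx⟩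

/-- Sets of points of one level are closed. -/
theorem isClosed_of_level_eq {α : W} {S : Set L.Space} (hS : ∀ x ∈ S, L.level x = α) :
    IsClosed S := by
  refine ⟨fun x hx ↦ ⟨L.rank (L.level x) α + 1, fun y hy hyS ↦ ?_⟩⟩
  rcases eq_or_level_lt hy with rfl | ⟨-, h⟩
  · exact hx hyS
  · rw [hS y hyS] at h
    omega

theorem discreteTopology_of_level_eq {α : W} {S : Set L.Space} (hS : ∀ x ∈ S, L.level x = α) :
    DiscreteTopology S :=
  discreteTopology_iff_forall_isClosed.2 fun T ↦
    isClosed_induced_iff.2 ⟨Subtype.val '' T, isClosed_of_level_eq (α := α) <| by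
      rintro _ ⟨x, -, rfl⟩
      exact hS x x.2, by simp [preimage_image_eq _ Subtype.val_injective]⟩

theorem accPt_of_step_mem {x : L.Space} (hx : x ∈ L.limit) {S : Set L.Space}
    (hS : ∀ n, L.step x n ∈ S) : AccPt x (𝓟 S) := by
  refine accPt_iff_nhds.2 fun V hV ↦ ?_
  obtain ⟨U, hUV, hU, hxU⟩ := mem_nhds_iff.1 hV
  obtain ⟨k, hk⟩ := hU x hxU
  refine ⟨L.step x k, ⟨hUV (hk (ball_step_subset hx le_rfl (mem_ball_self _ _))), hS k⟩, ?_⟩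
  exact fun h ↦ (L.level_step_lt x hx k).ne (congrArg L.level h)

end LadderSystem

theorem exists_ladderSystem (W : Type) [LinearOrder W] [Nonempty W]
    (hIio : ∀ w : W, (Iio w).Countable) (hW : #W ≤ 𝔠) :
    ∃ L : LadderSystem W, Function.Surjective L.level ∧
      ∀ s : ℕ → ℝ, ¬(closure (range s)).Countable → InjOn L.level (range s) →
        ∀ β, (∀ n, L.level (s n) < β) → ∃ h : ℝ → ℝ, Function.Injective h ∧
          ∀ ξ, L.level (h ξ) = β ∧ h ξ ∈ L.limit ∧ ∀ n, L.step (h ξ) n ∈ range s := by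
  obtain ⟨level, label, hlabel⟩ := exists_labelling W hW
  choose rank hrank using fun w ↦ (countable_iff_exists_injOn.1 (hIio w))
  let limit : Set ℝ := {x | InjOn level (range (label x)) ∧
    (∀ n, level (label x n) < level x) ∧ x ∈ closure (range (label x))}
  have hstep : ∀ x ∈ limit, ∀ n : ℕ, ∃ y ∈ range (label x),
      dist y x ≤ (1 / 2) ^ (n + 1) ∧ n ≤ rank (level x) (level y) := by
    rintro x ⟨hinj, hlt, hcl⟩ n
    have hlt' : ∀ y ∈ range (label x), level y < level x := by
      rintro _ ⟨m, rfl⟩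
      exact hlt m
    have hfin : {y ∈ range (label x) | rank (level x) (level y) < n}.Finite :=
      Finite.of_injOn (f := fun y ↦ rank (level x) (level y)) (t := Iio n) (fun y hy ↦ hy.2)
        (fun y hy z hz h ↦ hinj hy.1 hz.1 (hrank _ (hlt' y hy.1) (hlt' z hz.1) h))
        (finite_Iio n)
    have hsub : range (label x) ⊆ {y ∈ range (label x) | rank (level x) (level y) < n} ∪
        {y ∈ range (label x) | n ≤ rank (level x) (level y)} := fun y hy ↦
      (lt_or_ge (rank (level x) (level y)) n).imp (fun h ↦ ⟨hy, h⟩) fun h ↦ ⟨hy, h⟩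
    have hx := closure_mono hsub hcl
    rw [closure_union, hfin.isClosed.closure_eq] at hx
    rcases hx with hx | hx
    · exact absurd (hlt' x hx.1) (lt_irrefl _)
    · obtain ⟨y, hy, hdist⟩ := Metric.mem_closure_iff.1 hx ((1 / 2) ^ (n + 1)) (by positivity)
      exact ⟨y, hy.1, by rw [dist_comm]; exact hdist.le, hy.2⟩
  choose! step hstep_mem hstep_dist hstep_rank using hstep
  have hstep_lt : ∀ x ∈ limit, ∀ n, level (step x n) < level x := fun x hx n ↦ by
    obtain ⟨m, hm⟩ := hstep_mem x hx n
    rw [← hm]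
    exact hx.2.1 m
  have hindex : ∀ x ∈ limit, ∀ n : ℕ, ∃ m, n < m ∧ ∀ α < level (step x n),
      rank (level x) α < n → rank (level (step x n)) α < m := by
    intro x hx n
    have hfin : {α | α < level (step x n) ∧ rank (level x) α < n}.Finite :=
      Finite.of_injOn (f := rank (level x)) (t := Iio n) (fun α hα ↦ hα.2)
        ((hrank (level x)).mono fun α hα ↦ hα.1.trans (hstep_lt x hx n)) (finite_Iio n)
    obtain ⟨b, hb⟩ := (hfin.image (rank (level (step x n)))).bddAbove
    refine ⟨max n b + 1, by omega, fun α hα hn ↦ ?_⟩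
    have := hb (mem_image_of_mem _ ⟨hα, hn⟩)
    omega
  choose! index hindex_lt hindex_rank using hindex
  refine ⟨⟨level, rank, limit, step, index, hstep_lt, hstep_rank, hstep_dist, hindex_lt,
    hindex_rank⟩, fun β ↦ ?_, fun s hs hinj β hβ ↦ ?_⟩
  · obtain ⟨s, hs⟩ := TopologicalSpace.exists_dense_seq ℝ
    obtain ⟨h, -, hh⟩ := hlabel s (by rw [hs.closure_eq]; exact not_countable_univ) β
    exact ⟨h 0, (hh 0).2.1⟩
  · obtain ⟨h, hh_inj, hh⟩ := hlabel s hs β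
    have hlim : ∀ ξ, h ξ ∈ limit := fun ξ ↦ by
      obtain ⟨h1, h2, h3⟩ := hh ξ
      rw [← h3] at hinj h1
      exact ⟨hinj, fun n ↦ by rw [h2, h3]; exact hβ n, h1⟩
    refine ⟨h, hh_inj, fun ξ ↦ ⟨(hh ξ).2.1, hlim ξ, fun n ↦ ?_⟩⟩
    have := hstep_mem _ (hlim ξ) n
    rwa [(hh ξ).2.2] at this

/-- In a suitable ladder system on the countable ordinals, every set meeting uncountably many
levels has continuum many accumulation points on one level. -/
theorem exists_ladderSystem_accPt (W : Type) [LinearOrder W] [Uncountable W]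
    (hIio : ∀ w : W, (Iio w).Countable) (hW : #W ≤ 𝔠) :
    ∃ L : LadderSystem W, Function.Surjective L.level ∧
      ∀ T : Set L.Space, ¬(L.level '' T).Countable → ∃ β, ∃ h : ℝ → L.Space,
        Function.Injective h ∧ ∀ ξ, L.level (h ξ) = β ∧ AccPt (h ξ) (𝓟 T) := by
  obtain ⟨L, hsurj, hL⟩ := exists_ladderSystem W hIio hW
  refine ⟨L, hsurj, fun T hT ↦ ?_⟩
  obtain ⟨A, hAT, hA⟩ : ∃ A : Set ℝ, A ⊆ T ∧ BijOn L.level A (L.level '' T) :=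
    exists_subset_bijOn T L.level
  have hAunc : ¬A.Countable := fun h ↦ hT (hA.image_eq ▸ h.image _)
  obtain ⟨C, hCA, hC, hAC⟩ :=
    (TopologicalSpace.IsSeparable.of_separableSpace A).exists_countable_dense_subset
  have hCne : C.Nonempty := by
    rw [nonempty_iff_ne_empty]
    rintro rfl
    exact hAunc ((countable_empty (α := ℝ)).mono (by simpa using hAC))
  obtain ⟨s, rfl⟩ := hC.exists_eq_range hCne
  obtain ⟨β, hβ⟩ := exists_forall_lt_of_countable hIio (hC.image L.level)
  obtain ⟨h, hinj, hh⟩ := hL s (fun hc ↦ hAunc (hc.mono hAC)) (hA.injOn.mono hCA) β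
    fun n ↦ hβ _ (mem_image_of_mem _ (mem_range_self n))
  exact ⟨β, h, hinj, fun ξ ↦ ⟨(hh ξ).1,
    LadderSystem.accPt_of_step_mem (hh ξ).2.1 fun n ↦ hAT (hCA ((hh ξ).2.2 n))⟩⟩

theorem bddAbove_mk_closed_discrete (Y : Type*) [TopologicalSpace Y] :
    BddAbove {c : Cardinal | ∃ D : Set Y, IsClosed D ∧ DiscreteTopology ↥D ∧ #↥D = c} :=
  ⟨#Y, by
    rintro _ ⟨D, -, -, rfl⟩
    exact mk_set_le D⟩

/-- In a locally countable space whose cardinality does not exceed its extent, the extent equals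
the Lindelöf number. -/
theorem spaceExtent_eq_lindelofNumber {Y : Type*} [TopologicalSpace Y] (hY : LocallyCountable Y)
    (h : #Y ≤ spaceExtent Y) : spaceExtent Y = lindelofNumber Y := by
  have hmem : spaceExtent Y ∈ {κ : Cardinal | ℵ₀ ≤ κ ∧
      ∀ 𝓤 : Set (Set Y), (∀ u ∈ 𝓤, IsOpen u) → ⋃₀ 𝓤 = Set.univ →
        ∃ 𝓥 : Set (Set Y), 𝓥 ⊆ 𝓤 ∧ #↥𝓥 ≤ κ ∧ ⋃₀ 𝓥 = Set.univ} := by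
    refine ⟨le_max_left _ _, fun 𝓤 _ hcover ↦ ?_⟩
    choose V hV hyV using fun y ↦ mem_sUnion.1 (hcover.symm ▸ mem_univ y : y ∈ ⋃₀ 𝓤)
    exact ⟨range V, range_subset_iff.2 hV, mk_range_le.trans h,
      eq_univ_of_forall fun y ↦ ⟨V y, mem_range_self y, hyV y⟩⟩
  refine le_antisymm (le_csInf ⟨_, hmem⟩ ?_) (csInf_le' hmem)
  rintro κ ⟨hκ, hcover⟩
  obtain ⟨𝓥, hsub, hcard, huniv⟩ := hcover {U | IsOpen U ∧ U.Countable} (fun _ h ↦ h.1)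
    (eq_univ_of_forall fun y ↦ by
      obtain ⟨U, hU, hUc⟩ := hY y
      exact ⟨interior U, ⟨isOpen_interior, hUc.mono interior_subset⟩,
        mem_interior_iff_mem_nhds.2 hU⟩)
  have hYκ : #Y ≤ κ := by
    rw [← mk_univ, ← huniv, sUnion_eq_iUnion]
    refine (mk_iUnion_le _).trans (mul_le_of_le hκ hcard ((ciSup_le' fun V ↦ ?_).trans hκ))
    exact (hsub V.2).2.le_aleph0
  refine max_le hκ (csSup_le' ?_)
  rintro _ ⟨D, -, -, rfl⟩
  exact (mk_set_le D).trans hYκ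

theorem LocallyCountable.subtype {X : Type*} [TopologicalSpace X] (hX : LocallyCountable X)
    (F : Set X) : LocallyCountable F := fun x ↦ by
  obtain ⟨U, hU, hUc⟩ := hX x
  exact ⟨Subtype.val ⁻¹' U, preimage_coe_mem_nhds_subtype.2 (mem_nhdsWithin_of_mem_nhds hU),
    hUc.preimage Subtype.val_injective⟩

namespace LadderSystem

variable {W : Type} [LinearOrder W] {L : LadderSystem W}

theorem mk_level_le_spaceExtent (F : Set L.Space) (α : W) :
    #{x : F | L.level (x : L.Space) = α} ≤ spaceExtent F := by
  refine le_max_of_le_right (le_csSup (bddAbove_mk_closed_discrete F)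
    ⟨{x : F | L.level (x : L.Space) = α}, ?_, ?_, rfl⟩)
  · exact (isClosed_of_level_eq (S := {x : L.Space | L.level x = α}) fun _ h ↦ h).preimage
      continuous_subtype_val
  · have := discreteTopology_of_level_eq (S := {x : L.Space | L.level x = α}) fun _ h ↦ h
    exact DiscreteTopology.of_continuous_injective
      (f := fun x : {x : F | L.level (x : L.Space) = α} ↦
        (⟨x.1.1, x.2⟩ : {x : L.Space | L.level x = α})) (by fun_prop)
      fun x y h ↦ Subtype.ext (Subtype.ext
        (congrArg (fun z : {x : L.Space | L.level x = α} ↦ z.1) h))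

theorem mk_le_spaceExtent
    (hL : ∀ T : Set L.Space, ¬(L.level '' T).Countable → ∃ β, ∃ h : ℝ → L.Space,
      Function.Injective h ∧ ∀ ξ, L.level (h ξ) = β ∧ AccPt (h ξ) (𝓟 T))
    {F : Set L.Space} (hF : IsClosed F) : #F ≤ spaceExtent F := by
  by_cases hc : (L.level '' F).Countable
  · have huniv : (univ : Set F) = ⋃ α ∈ L.level '' F, {x : F | L.level (x : L.Space) = α} :=
      (eq_univ_of_forall fun x ↦ mem_biUnion (mem_image_of_mem _ x.2) rfl).symm
    rw [← mk_univ, huniv]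
    exact (mk_biUnion_le _ _).trans (mul_le_of_le (le_max_left _ _)
      (hc.le_aleph0.trans (le_max_left _ _)) (ciSup_le' fun α ↦ mk_level_le_spaceExtent F α))
  · obtain ⟨β, h, hinj, hh⟩ := hL F hc
    have hmem : ∀ ξ, h ξ ∈ F := fun ξ ↦ hF.closure_eq ▸ (hh ξ).2.clusterPt.mem_closure
    refine le_trans ?_ (mk_level_le_spaceExtent F β)
    exact (mk_set_le F).trans (mk_le_of_injective
      (f := fun ξ : ℝ ↦ (⟨⟨h ξ, hmem ξ⟩, (hh ξ).1⟩ : {x : F | L.level (x : L.Space) = β}))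
      fun ξ η e ↦ hinj (congrArg (fun x ↦ x.1.1) e))

theorem not_isLinearlyDSpace [Uncountable W] (hIio : ∀ w : W, (Iio w).Countable)
    (hsurj : Function.Surjective L.level)
    (hL : ∀ T : Set L.Space, ¬(L.level '' T).Countable → ∃ x, AccPt x (𝓟 T)) :
    ¬IsLinearlyDSpace L.Space := by
  intro hD
  obtain ⟨D, hDc, hDd, hDuniv⟩ := hD (fun x ↦ {y | L.level y ≤ L.level x})
    (fun x ↦ isOpen_setOf_level_le _) (fun x ↦ le_refl (L.level x)) fun x y ↦
      (le_total (L.level x) (L.level y)).imp (fun h _ hz ↦ le_trans hz h)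
        fun h _ hz ↦ le_trans hz h
  obtain ⟨x, hx⟩ := hL D fun hc ↦ by
    obtain ⟨β, hβ⟩ := exists_forall_lt_of_countable hIio hc
    obtain ⟨x, rfl⟩ := hsurj β
    obtain ⟨d, hd, hxd⟩ := mem_iUnion₂.1 (hDuniv.symm ▸ mem_univ (α := L.Space) x)
    exact (hβ _ (mem_image_of_mem _ hd)).not_ge hxd
  have hxD : x ∈ D := hDc.closure_eq ▸ hx.clusterPt.mem_closure
  exact hx.ne (discreteTopology_subtype_iff.1 hDd x hxD)

end LadderSystem

/-- In ZFC there is a Hausdorff, locally countable, locally compact,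
0-dimensional space of cardinality `2^ℵ₀`, not linearly D, in which
`e(F) = L(F)` for every closed `F`. -/
theorem stmt11 :
    ∃ (X : Type) (t : TopologicalSpace X),
      @T2Space X t ∧ #X = 2 ^ Cardinal.aleph0 ∧ @LocallyCountable X t ∧
      @LocallyCompactSpace X t ∧ @ZeroDimensional X t ∧ ¬@IsLinearlyDSpace X t ∧
      ∀ F : Set X, @IsClosed X t F →
        @spaceExtent ↥F (TopologicalSpace.induced Subtype.val t) =
          @lindelofNumber ↥F (TopologicalSpace.induced Subtype.val t) := by
  let W := (ℵ₁ : Cardinal.{0}).ord.ToType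
  have hW : #W = ℵ₁ := by simp [W]
  have hIio : ∀ w : W, (Iio w).Countable := fun w ↦ by
    rw [← le_aleph0_iff_set_countable, ← Order.lt_succ_iff, succ_aleph0]
    exact (mk_Iio_lt w (by simp [W])).trans_eq hW
  have : Uncountable W := by
    rw [← aleph0_lt_mk_iff, hW]
    exact aleph0_lt_aleph_one
  obtain ⟨L, hsurj, hL⟩ :=
    exists_ladderSystem_accPt W hIio (hW.trans_le aleph_one_le_continuum)
  refine ⟨L.Space, inferInstance, inferInstance, ?_, L.locallyCountable, inferInstance,
    L.zeroDimensional, LadderSystem.not_isLinearlyDSpace hIio hsurj fun T hT ↦ ?_,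
    fun F hF ↦ spaceExtent_eq_lindelofNumber (L.locallyCountable.subtype F)
      (LadderSystem.mk_le_spaceExtent hL hF)⟩
  · rw [two_power_aleph0]
    exact mk_real
  · obtain ⟨_, h, -, hh⟩ := hL T hT
    exact ⟨h 0, (hh 0).2⟩
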